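/- Let n ≥ 3, let φ̃ : ℝⁿ → ℝⁿ × ℝⁿ × ℝ ≅ ℝ^{2n+1} be φ̃(t₁,…,tₙ) = ((cos t₁ − 1, …, cos tₙ − 1), (sin t₁, …, sin tₙ), ½∑_{j=1}^n (t_j − sin t_j)), and let S = φ̃(ℝⁿ) be its image. For r > 0 let B_r = { (x,y,φ) ∈ ℝⁿ × ℝⁿ × ℝ : (|x|² + |y|²)² + 16φ² < r⁴ } be the Korányi ball of radius r. Then, with μ the n-dimensional Hausdorff measure on the Euclidean space ℝ^{2n+1}, there exists C > 0 such that μ(S ∩ B_r) ≤ C·r² for all r ≥ 1; consequently μ(S ∩ B_r)/rⁿ → 0 as r → ∞. In particular the n-dimensional area density ratio of this Hamiltonian-stationary Legendrian submanifold is not monotone and admits no uniform lower bound at large scales. -/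

import Mathlib

open MeasureTheory Filter
open scoped BigOperators ENNReal

/-- The Legendrian lift of (an exact covering of) the generalized Clifford torus:
`φ̃(t) = ((cos tᵢ − 1)ᵢ, (sin tᵢ)ᵢ, ½ ∑ⱼ (tⱼ − sin tⱼ))` as a map into the
Heisenberg group `ℝⁿ × ℝⁿ × ℝ ≅ ℝ^{2n+1}`. -/
noncomputable def cliffordLift (n : ℕ) (t : Fin n → ℝ) :
    (Fin n → ℝ) × (Fin n → ℝ) × ℝ :=
  (fun i => Real.cos (t i) - 1, fun i => Real.sin (t i),
    (1 / 2) * ∑ j, (t j - Real.sin (t j)))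

/-- The open Korányi ball `B_r = {(x,y,φ) : (|x|² + |y|²)² + 16φ² < r⁴}`. -/
def koranyiBall (n : ℕ) (r : ℝ) : Set ((Fin n → ℝ) × (Fin n → ℝ) × ℝ) :=
  {ξ | (((∑ i, ξ.1 i ^ 2) + ∑ i, ξ.2.1 i ^ 2) ^ 2 + 16 * ξ.2.2 ^ 2) < r ^ 4}

/-- The Legendrian lift is Lipschitz for the sup metrics. -/
lemma lipschitzWith_cliffordLift (n : ℕ) :
    LipschitzWith (n + 1 : NNReal) (cliffordLift n) := by
  refine LipschitzWith.of_dist_le_mul fun s t => ?_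
  have hd : 0 ≤ dist s t := dist_nonneg
  have hn : (0 : ℝ) ≤ n := Nat.cast_nonneg n
  have hK : dist s t ≤ ((n + 1 : NNReal) : ℝ) * dist s t := by
    push_cast
    nlinarith
  have hj : ∀ j, |s j - t j| ≤ dist s t := fun j => by
    simpa [Real.dist_eq] using dist_le_pi_dist s t j
  have hsin : ∀ j, |Real.sin (s j) - Real.sin (t j)| ≤ dist s t := fun j =>
    (Real.abs_sin_sub_sin_le (s j) (t j)).trans (hj j)
  have hcos : ∀ j, |Real.cos (s j) - Real.cos (t j)| ≤ dist s t := fun j =>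
    (Real.abs_cos_sub_cos_le (s j) (t j)).trans (hj j)
  refine max_le ?_ (max_le ?_ ?_)
  · refine ((dist_pi_le_iff hd).2 fun j => ?_).trans hK
    simpa [cliffordLift, Real.dist_eq] using hcos j
  · refine ((dist_pi_le_iff hd).2 fun j => ?_).trans hK
    simpa [cliffordLift, Real.dist_eq] using hsin j
  · have hsum : |∑ j, ((s j - Real.sin (s j)) - (t j - Real.sin (t j)))|
        ≤ n * (2 * dist s t) := by
      refine (Finset.abs_sum_le_sum_abs _ _).trans ?_
      refine (Finset.sum_le_card_nsmul _ _ (2 * dist s t) fun j _ => ?_).trans_eq (by simp)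
      have h₁ := abs_le.1 (hj j)
      have h₂ := abs_le.1 (hsin j)
      exact abs_le.2 ⟨by linarith, by linarith⟩
    simp only [cliffordLift, Real.dist_eq]
    rw [← mul_sub, ← Finset.sum_sub_distrib, abs_mul, abs_of_pos (by norm_num : (0 : ℝ) < 1 / 2)]
    push_cast
    linarith

/-- The image of the fundamental cube has finite `n`-dimensional Hausdorff measure. -/
lemma hausdorffMeasure_cliffordLift_cube_lt_top (n : ℕ) :
    μH[(n : ℝ)] (cliffordLift n '' Set.Icc 0 (fun _ => 2 * Real.pi)) < ∞ := by
  refine ((lipschitzWith_cliffordLift n).hausdorffMeasure_image_le (Nat.cast_nonneg n) _).trans_lt ?_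
  have h : (μH[(n : ℝ)] : Measure (Fin n → ℝ)) = volume := by
    simpa using hausdorffMeasure_pi_real (ι := Fin n)
  rw [h]
  exact ENNReal.mul_lt_top (ENNReal.rpow_lt_top_of_nonneg (Nat.cast_nonneg n) ENNReal.coe_ne_top)
    isCompact_Icc.measure_lt_top

/-- Translating the parameter by a period lattice vector translates the lift vertically. -/
lemma cliffordLift_add_int_mul_two_pi (n : ℕ) (s : Fin n → ℝ) (k : Fin n → ℤ) :
    cliffordLift n (fun j => s j + k j * (2 * Real.pi)) =
      cliffordLift n s + (0, 0, Real.pi * ((∑ j, k j : ℤ) : ℝ)) := by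
  simp only [cliffordLift, Real.cos_add_int_mul_two_pi, Real.sin_add_int_mul_two_pi, Prod.mk_add_mk,
    add_zero]
  congr 2
  push_cast
  rw [Finset.mul_sum, Finset.mul_sum, Finset.mul_sum, ← Finset.sum_add_distrib]
  exact Finset.sum_congr rfl fun j _ => by ring

/-- The height of the lift of the fundamental cube lies in `[0, nπ]`. -/
lemma cliffordLift_height_mem_Icc (n : ℕ) {s : Fin n → ℝ}
    (hs : s ∈ Set.Icc 0 (fun _ => 2 * Real.pi)) :
    (cliffordLift n s).2.2 ∈ Set.Icc 0 (n * Real.pi) := by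
  have h₀ : ∀ j, 0 ≤ s j - Real.sin (s j) := fun j => sub_nonneg.2 (Real.sin_le (hs.1 j))
  have h₁ : ∀ j, s j - Real.sin (s j) ≤ 2 * Real.pi := fun j => by
    have h := Real.sin_le (sub_nonneg.2 (hs.2 j))
    rw [Real.sin_two_pi_sub] at h
    linarith
  have hsum : ∑ j, (s j - Real.sin (s j)) ≤ n * (2 * Real.pi) :=
    (Finset.sum_le_card_nsmul _ _ (2 * Real.pi) fun j _ => h₁ j).trans_eq (by simp)
  have hpos : 0 ≤ ∑ j, (s j - Real.sin (s j)) := Finset.sum_nonneg fun j _ => h₀ j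
  simp only [cliffordLift, Set.mem_Icc]
  constructor <;> linarith

/-- The part of the lift inside `B_r` is covered by `O(r²)` vertical translates of the lift of the
fundamental cube. -/
lemma range_cliffordLift_inter_koranyiBall_subset (n : ℕ) {r : ℝ} :
    Set.range (cliffordLift n) ∩ koranyiBall n r ⊆
      ⋃ m ∈ Finset.Icc (-(⌊r ^ 2 + n⌋₊ : ℤ)) ⌊r ^ 2 + n⌋₊,
        (fun p => p + ((0, 0, Real.pi * (m : ℝ)) : (Fin n → ℝ) × (Fin n → ℝ) × ℝ)) ''
          (cliffordLift n '' Set.Icc 0 (fun _ => 2 * Real.pi)) := by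
  rintro _ ⟨⟨t, rfl⟩, hball⟩
  have h2π := Real.two_pi_pos
  set k : Fin n → ℤ := fun j => ⌊t j / (2 * Real.pi)⌋
  set s : Fin n → ℝ := fun j => t j - k j * (2 * Real.pi)
  have hs : s ∈ Set.Icc 0 (fun _ => 2 * Real.pi) := by
    refine ⟨fun j => ?_, fun j => ?_⟩
    · exact sub_nonneg.2 ((le_div_iff₀ h2π).1 (Int.floor_le _))
    · have h := (div_lt_iff₀ h2π).1 (Int.lt_floor_add_one (t j / (2 * Real.pi)))
      simp only [s, k]
      linarith
  have ht : cliffordLift n t = cliffordLift n s + (0, 0, Real.pi * ((∑ j, k j : ℤ) : ℝ)) := by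
    rw [← cliffordLift_add_int_mul_two_pi]
    simp [s]
  refine Set.mem_biUnion (x := ∑ j, k j) ?_ ⟨_, ⟨s, hs, rfl⟩, ht.symm⟩
  have hheight : |(cliffordLift n t).2.2| ≤ r ^ 2 := by
    refine abs_le_of_sq_le_sq ?_ (sq_nonneg r)
    have h : _ < r ^ 4 := hball
    nlinarith [sq_nonneg ((∑ i, (cliffordLift n t).1 i ^ 2) + ∑ i, (cliffordLift n t).2.1 i ^ 2),
      sq_nonneg (cliffordLift n t).2.2]
  obtain ⟨h₀, h₁⟩ := cliffordLift_height_mem_Icc n hs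
  rw [ht] at hheight
  simp only [Prod.snd_add] at hheight
  obtain ⟨h₂, h₃⟩ := abs_le.1 hheight
  set m := ∑ j, k j
  have hπ : 1 ≤ Real.pi := by linarith [Real.pi_gt_three]
  have hn : (0 : ℝ) ≤ n := Nat.cast_nonneg n
  have hr : 0 ≤ r ^ 2 := sq_nonneg r
  have hm : |(m : ℝ)| ≤ r ^ 2 + n := by
    refine abs_le.2 ⟨?_, ?_⟩ <;> by_contra! hlt <;> nlinarith
  have hnat : m.natAbs ≤ ⌊r ^ 2 + n⌋₊ := Nat.le_floor (by rwa [Nat.cast_natAbs, Int.cast_abs])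
  have habs : |m| ≤ (⌊r ^ 2 + n⌋₊ : ℤ) := by
    rw [Int.abs_eq_natAbs]
    exact_mod_cast hnat
  exact Finset.mem_coe.2 (Finset.mem_Icc.2 (abs_le.1 habs))

/-- Quadratic growth of the area of the lift in Korányi balls. -/
lemma hausdorffMeasure_cliffordLift_koranyiBall_le (n : ℕ) {r : ℝ} (hr : 1 ≤ r) :
    μH[(n : ℝ)] (Set.range (cliffordLift n) ∩ koranyiBall n r) ≤
      ENNReal.ofReal ((2 * n + 3) *
        ((μH[(n : ℝ)] (cliffordLift n '' Set.Icc 0 (fun _ => 2 * Real.pi))).toReal + 1) * r ^ 2) := by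
  set M := μH[(n : ℝ)] (cliffordLift n '' Set.Icc 0 (fun _ => 2 * Real.pi))
  have hfin : M ≠ ∞ := (hausdorffMeasure_cliffordLift_cube_lt_top n).ne
  set N := ⌊r ^ 2 + n⌋₊
  have hcard : (Finset.Icc (-(N : ℤ)) N).card = 2 * N + 1 := by
    rw [Int.card_Icc]
    lia
  have hN : (N : ℝ) ≤ r ^ 2 + n := Nat.floor_le (by positivity)
  calc μH[(n : ℝ)] (Set.range (cliffordLift n) ∩ koranyiBall n r)
      ≤ ∑ m ∈ Finset.Icc (-(N : ℤ)) N, μH[(n : ℝ)]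
          ((fun p => p + ((0, 0, Real.pi * (m : ℝ)) : (Fin n → ℝ) × (Fin n → ℝ) × ℝ)) ''
            (cliffordLift n '' Set.Icc 0 (fun _ => 2 * Real.pi))) :=
        (measure_mono (range_cliffordLift_inter_koranyiBall_subset n)).trans
          (measure_biUnion_finset_le _ _)
    _ = ∑ _m ∈ Finset.Icc (-(N : ℤ)) N, M :=
        Finset.sum_congr rfl fun m _ =>
          (IsometryEquiv.addRight
            ((0, 0, Real.pi * (m : ℝ)) : (Fin n → ℝ) × (Fin n → ℝ) × ℝ)).hausdorffMeasure_image _ _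
    _ = ENNReal.ofReal ((2 * N + 1) * M.toReal) := by
        rw [ENNReal.ofReal_mul (by positivity), ENNReal.ofReal_toReal hfin, Finset.sum_const,
          hcard, nsmul_eq_mul]
        congr 1
        exact_mod_cast (ENNReal.ofReal_natCast (2 * N + 1)).symm
    _ ≤ _ := by
        refine ENNReal.ofReal_le_ofReal ?_
        have hM₀ : 0 ≤ M.toReal := ENNReal.toReal_nonneg
        have hr₂ : 1 ≤ r ^ 2 := one_le_pow₀ hr
        have hn : (0 : ℝ) ≤ n := Nat.cast_nonneg n
        have hle : 2 * (N : ℝ) + 1 ≤ (2 * n + 3) * r ^ 2 := by nlinarith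
        calc (2 * (N : ℝ) + 1) * M.toReal ≤ ((2 * n + 3) * r ^ 2) * (M.toReal + 1) := by
              gcongr
              linarith
          _ = _ := by ring

/-- Failure of large-scale lower area density bounds for the lifted Clifford torus in
dimension `n ≥ 3`: denoting by `μH[n]` the `n`-dimensional Hausdorff measure and by
`S` the image of the Legendrian lift `φ̃` of the generalized Clifford torus, there is
`C > 0` with `μH[n](S ∩ B_r) ≤ C r²` for all `r ≥ 1`; consequently
`μH[n](S ∩ B_r)/rⁿ → 0` as `r → ∞`. -/
theorem cliffordLift_no_density_lower_bound (n : ℕ) (hn : 3 ≤ n) :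
    ∃ C : ℝ, 0 < C ∧
      (∀ r : ℝ, 1 ≤ r →
        μH[(n : ℝ)] (Set.range (cliffordLift n) ∩ koranyiBall n r)
          ≤ ENNReal.ofReal (C * r ^ 2)) ∧
      Tendsto
        (fun r : ℝ =>
          μH[(n : ℝ)] (Set.range (cliffordLift n) ∩ koranyiBall n r)
            / ENNReal.ofReal (r ^ n))
        atTop (nhds 0) := by
  refine ⟨(2 * n + 3) *
    ((μH[(n : ℝ)] (cliffordLift n '' Set.Icc 0 (fun _ => 2 * Real.pi))).toReal + 1), by positivity,
    fun r hr => hausdorffMeasure_cliffordLift_koranyiBall_le n hr, ?_⟩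
  set C : ℝ := (2 * n + 3) *
    ((μH[(n : ℝ)] (cliffordLift n '' Set.Icc 0 (fun _ => 2 * Real.pi))).toReal + 1)
  have hC₀ : 0 ≤ C := by positivity
  have hlim : Tendsto (fun r : ℝ => ENNReal.ofReal (C / r)) atTop (nhds 0) := by
    simpa using ENNReal.tendsto_ofReal (tendsto_const_nhds (x := C) |>.div_atTop tendsto_id)
  refine tendsto_of_tendsto_of_tendsto_of_le_of_le' tendsto_const_nhds hlim
    (Eventually.of_forall fun _ => zero_le) ?_
  filter_upwards [eventually_ge_atTop 1] with r hr
  have hr₀ : 0 < r := by linarith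
  refine (ENNReal.div_le_div_right (hausdorffMeasure_cliffordLift_koranyiBall_le n hr) _).trans ?_
  rw [← ENNReal.ofReal_div_of_pos (by positivity)]
  refine ENNReal.ofReal_le_ofReal ?_
  rw [div_le_div_iff₀ (by positivity) hr₀]
  calc C * r ^ 2 * r = C * r ^ 3 := by ring
    _ ≤ C * r ^ n := by gcongr
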